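/- If J is an ideal of R that is maximal among proper ℤ^n-invariant ideals of R, then for each i ∈ {1,…,n} the image t_i + J is a regular element (not a zero divisor) of the quotient ring R/J. -/

import Mathlib

namespace MTW

abbrev Exp (n : ℕ) : Type := (Fin n → ℤ) × (Fin n → ℤ)

abbrev LR (K : Type) [Field K] (n : ℕ) : Type := AddMonoidAlgebra K (Exp n)

noncomputable def mon (K : Type) [Field K] (n : ℕ) (d : Exp n) : LR K n :=
  AddMonoidAlgebra.single d 1

noncomputable def U (K : Type) [Field K] (n : ℕ) (j : Fin n) : LR K n :=
  mon K n (Pi.single j 1, 0)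

noncomputable def V (K : Type) [Field K] (n : ℕ) (j : Fin n) : LR K n :=
  mon K n (0, Pi.single j 1)

noncomputable def tElt (K : Type) [Field K] (n : ℕ) (k : ℤ) (r s : Fin n → Fin n → K)
    (i : Fin n) : LR K n :=
  (r i i ^ k - s i i ^ k)⁻¹ •
    (r i i ^ k • mon K n (Pi.single i k, 0) - s i i ^ k • mon K n (0, Pi.single i k))

noncomputable def sigmaZ (K : Type) [Field K] (n : ℕ)
    (σ : Fin n → (LR K n ≃ₐ[K] LR K n)) (g : Fin n → ℤ) : LR K n ≃ₐ[K] LR K n :=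
  (List.ofFn fun i => σ i ^ (g i)).prod

def IsInvariantIdeal (K : Type) [Field K] (n : ℕ)
    (σ : Fin n → (LR K n ≃ₐ[K] LR K n)) (J : Ideal (LR K n)) : Prop :=
  ∀ (g : Fin n → ℤ), ∀ x ∈ J, sigmaZ K n σ g x ∈ J

noncomputable def invariants (K : Type) [Field K] (n : ℕ)
    (σ : Fin n → (LR K n ≃ₐ[K] LR K n)) : Subalgebra K (LR K n) :=
  ⨅ i, AlgHom.equalizer (σ i).toAlgHom (AlgHom.id K (LR K n))

theorem prod_ofFn_eq_of_forall_ne {M : Type*} [Monoid M] :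
    ∀ {n : ℕ} (f : Fin n → M) (i : Fin n), (∀ j, j ≠ i → f j = 1) → (List.ofFn f).prod = f i := by
  intro n
  induction n with
  | zero => intro f i; exact i.elim0
  | succ n ih =>
    intro f i h
    rw [List.ofFn_succ, List.prod_cons]
    induction i using Fin.cases with
    | zero =>
      have hone : (List.ofFn fun j : Fin n => f j.succ).prod = 1 := by
        apply List.prod_eq_one
        intro x hx
        obtain ⟨j, rfl⟩ := (List.mem_ofFn' _ _).1 hx
        exact h _ (Fin.succ_ne_zero j)
      rw [hone, mul_one]
    | succ i =>
      rw [h 0 (Fin.succ_ne_zero i).symm, one_mul]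
      exact ih (fun j => f j.succ) i fun j hj => h _ fun e => hj (Fin.succ_injective _ e)

theorem sigmaZ_single (K : Type) [Field K] (n : ℕ) (σ : Fin n → (LR K n ≃ₐ[K] LR K n))
    (i : Fin n) (m : ℤ) : sigmaZ K n σ (Pi.single i m) = σ i ^ m := by
  unfold sigmaZ
  rw [prod_ofFn_eq_of_forall_ne _ i]
  · simp
  · intro j hj
    simp [hj]

theorem mon_add (K : Type) [Field K] (n : ℕ) (d e : Exp n) :
    mon K n (d + e) = mon K n d * mon K n e := by
  simp [mon, AddMonoidAlgebra.single_mul_single]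

theorem isUnit_mon (K : Type) [Field K] (n : ℕ) (d : Exp n) : IsUnit (mon K n d) := by
  refine IsUnit.of_mul_eq_one (mon K n (-d)) ?_
  rw [← mon_add, add_neg_cancel]
  rfl

theorem map_mon_zsmul {K : Type} [Field K] {n : ℕ} (φ : LR K n ≃ₐ[K] LR K n) (d : Exp n) {c : K}
    (hc : c ≠ 0) (h : φ (mon K n d) = c • mon K n d) (k : ℤ) :
    φ (mon K n (k • d)) = c ^ k • mon K n (k • d) := by
  have step : ∀ j : ℤ, φ (mon K n ((j + 1) • d)) = c • (φ (mon K n (j • d)) * mon K n d) := by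
    intro j
    rw [add_smul, one_smul, mon_add, map_mul, h, mul_smul_comm]
  induction k with
  | zero =>
    rw [zero_smul, zpow_zero, one_smul]
    exact map_one φ
  | succ j ih =>
    rw [step, ih, smul_mul_assoc, ← mon_add, smul_smul, zpow_add_one₀ hc, mul_comm c, add_smul,
      one_smul]
  | pred j ih =>
    have hstep := step (-j - 1)
    rw [sub_add_cancel, ih] at hstep
    apply (isUnit_mon K n d).mul_right_cancel
    rw [smul_mul_assoc, ← mon_add]
    have hexp : (-(j : ℤ) - 1) • d + d = (-(j : ℤ)) • d := by
      rw [sub_smul, one_smul, sub_add_cancel]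
    rw [hexp, zpow_sub_one₀ hc, mul_comm (c ^ _), ← smul_smul, hstep, smul_smul, inv_mul_cancel₀ hc,
      one_smul]

theorem pow_apply_of_apply_eq_smul {K A : Type*} [CommSemiring K] [Semiring A] [Algebra K A]
    (φ : A ≃ₐ[K] A) {x : A} {c : K} (h : φ x = c • x) (m : ℕ) : (φ ^ m) x = c ^ m • x := by
  induction m with
  | zero => simp
  | succ m ih => rw [pow_succ, AlgEquiv.mul_apply, h, map_smul, ih, smul_smul, pow_succ']

theorem isNoetherianRing_LR (K : Type) [Field K] (n : ℕ) : IsNoetherianRing (LR K n) :=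
  Algebra.FiniteType.isNoetherianRing K (LR K n)

theorem zpow_ne_one_of_forall_pow_ne_one {K : Type*} [DivisionRing K] {q : K}
    (h : ∀ m : ℕ, 0 < m → q ^ m ≠ 1) {z : ℤ} (hz : z ≠ 0) : q ^ z ≠ 1 := by
  rcases Int.natAbs_eq z with e | e <;> rw [e]
  · rw [zpow_natCast]
    exact h _ (Int.natAbs_pos.2 hz)
  · rw [zpow_neg, zpow_natCast, Ne, inv_eq_one]
    exact h _ (Int.natAbs_pos.2 hz)

/-- In a Noetherian ring, a sequence of elements no two of which lie in a common prime ideal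
contains a nonzerodivisor. -/
theorem exists_mem_nonZeroDivisors_of_pairwise {A : Type*} [CommRing A] [IsNoetherianRing A]
    (q : ℕ → A) (h : ∀ P : Ideal A, P.IsPrime → ∀ a b, a < b → q a ∈ P → q b ∉ P) :
    ∃ m, q m ∈ nonZeroDivisors A := by
  by_contra! hq
  have hex : ∀ m, ∃ P ∈ associatedPrimes A A, q m ∈ P := by
    intro m
    have hm : q m ∈ ⋃ p ∈ associatedPrimes A A, (p : Set A) := by
      rw [biUnion_associatedPrimes_eq_compl_nonZeroDivisors]
      exact hq m
    simpa using hm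
  choose P hP hqP using hex
  have : Finite (associatedPrimes A A) := (associatedPrimes.finite A A).to_subtype
  obtain ⟨a, b, hab, e⟩ :=
    Finite.exists_ne_map_eq_of_infinite fun m => (⟨P m, hP m⟩ : associatedPrimes A A)
  have e : P a = P b := congrArg Subtype.val e
  rcases hab.lt_or_gt with hlt | hlt
  · exact h (P a) (hP a).isPrime a b hlt (hqP a) (e ▸ hqP b)
  · exact h (P b) (hP b).isPrime b a hlt (hqP b) (e ▸ hqP a)

theorem notMem_of_mem_of_isPrime {K A : Type*} [Field K] [CommRing A] [Algebra K A] {P : Ideal A}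
    (hP : P.IsPrime) {X Y : A} (hX : IsUnit X) {a b a' b' d : K} (hd : d ≠ 0)
    (hdet : a * b' - a' * b ≠ 0) (h : d • (a • X - b • Y) ∈ P) : d • (a' • X - b' • Y) ∉ P := by
  intro h'
  have hcomb : (d * (a * b' - a' * b)) • X ∈ P := by
    have := P.sub_mem (Submodule.smul_of_tower_mem P b' h) (Submodule.smul_of_tower_mem P b h')
    convert this using 1
    module
  have hXP : X ∈ P := by
    have := Submodule.smul_of_tower_mem P (d * (a * b' - a' * b))⁻¹ hcomb
    rwa [smul_smul, inv_mul_cancel₀ (mul_ne_zero hd hdet), one_smul] at this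
  exact hP.ne_top (P.eq_top_of_isUnit_mem hXP hX)

theorem pow_apply_tElt {K : Type} [Field K] {n : ℕ} (k : ℤ) {r s : Fin n → Fin n → K} {i : Fin n}
    (hr : r i i ≠ 0) (hs : s i i ≠ 0) (φ : LR K n ≃ₐ[K] LR K n)
    (hu : φ (U K n i) = (r i i)⁻¹ • U K n i) (hv : φ (V K n i) = (s i i)⁻¹ • V K n i) (m : ℕ) :
    (φ ^ m) (tElt K n k r s i) = (r i i ^ k - s i i ^ k)⁻¹ •
      ((r i i ^ k * ((r i i)⁻¹ ^ k) ^ m) • mon K n (Pi.single i k, 0) -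
        (s i i ^ k * ((s i i)⁻¹ ^ k) ^ m) • mon K n (0, Pi.single i k)) := by
  have eu : k • ((Pi.single i 1, 0) : Exp n) = (Pi.single i k, 0) := by
    simp [← Pi.single_smul]
  have ev : k • ((0, Pi.single i 1) : Exp n) = (0, Pi.single i k) := by
    simp [← Pi.single_smul]
  have hX := map_mon_zsmul φ _ (inv_ne_zero hr) hu k
  have hY := map_mon_zsmul φ _ (inv_ne_zero hs) hv k
  rw [eu] at hX
  rw [ev] at hY
  rw [tElt, map_smul, map_sub, map_smul, map_smul, pow_apply_of_apply_eq_smul φ hX,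
    pow_apply_of_apply_eq_smul φ hY, smul_smul, smul_smul]

theorem mk_mem_nonZeroDivisors_of_mk_apply {A : Type*} [CommRing A] {J : Ideal A} (φ : A ≃+* A)
    (h : ∀ x ∈ J, φ x ∈ J) (h' : ∀ x ∈ J, φ.symm x ∈ J) {t : A}
    (ht : Ideal.Quotient.mk J (φ t) ∈ nonZeroDivisors (A ⧸ J)) :
    Ideal.Quotient.mk J t ∈ nonZeroDivisors (A ⧸ J) := by
  rw [mem_nonZeroDivisors_iff_right] at ht ⊢
  intro x hx
  obtain ⟨x, rfl⟩ := Ideal.Quotient.mk_surjective x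
  rw [← map_mul, Ideal.Quotient.eq_zero_iff_mem] at hx
  have hφ := ht (Ideal.Quotient.mk J (φ x)) (by
    rw [← map_mul, ← map_mul, Ideal.Quotient.eq_zero_iff_mem]
    exact h _ hx)
  rw [Ideal.Quotient.eq_zero_iff_mem] at hφ ⊢
  simpa using h' _ hφ

/-- If `J` is maximal among proper `ℤ^n`-invariant ideals of `R`, then
for each `i` the image of `t_i` in `R/J` is a regular element (a nonzerodivisor). -/
theorem statement5
    (K : Type) [Field K] (n : ℕ) (hn : 0 < n)
    (k : ℤ) (hk : k ≠ 0) (r s : Fin n → Fin n → K)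
    (hr : ∀ i j, r i j ≠ 0) (hs : ∀ i j, s i j ≠ 0)
    (hroot : ∀ i, ∀ m : ℕ, 0 < m → (r i i / s i i) ^ m ≠ 1)
    (hrs : ∀ i j, i ≠ j → r i j ^ k = s i j ^ k)
    (σ : Fin n → (LR K n ≃ₐ[K] LR K n))
    (hσu : ∀ i j, σ i (U K n j) = (r i j)⁻¹ • U K n j)
    (hσv : ∀ i j, σ i (V K n j) = (s i j)⁻¹ • V K n j)
    (J : Ideal (LR K n)) (hJ : J ≠ ⊤) (hJinv : IsInvariantIdeal K n σ J)
    (hJmax : ∀ J' : Ideal (LR K n), IsInvariantIdeal K n σ J' → J' ≠ ⊤ → J ≤ J' → J' = J)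
    (i : Fin n) :
    Ideal.Quotient.mk J (tElt K n k r s i) ∈ nonZeroDivisors (LR K n ⧸ J) := by
  have := isNoetherianRing_LR K n
  have hpow : ∀ z : ℤ, ∀ x ∈ J, (σ i ^ z) x ∈ J := fun z x hx => by
    rw [← sigmaZ_single]
    exact hJinv _ x hx
  obtain ⟨m, hm⟩ := exists_mem_nonZeroDivisors_of_pairwise
    (fun m => Ideal.Quotient.mk J ((σ i ^ m) (tElt K n k r s i))) (by
      intro P hP a b hab ha hb
      rw [← Ideal.mem_comap, pow_apply_tElt k (hr i i) (hs i i) (σ i) (hσu i i) (hσv i i)] at ha hb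
      have hr0 := zpow_ne_zero k (hr i i)
      have hs0 := zpow_ne_zero k (hs i i)
      have hq : ∀ c : ℕ, 0 < c → (r i i ^ k) ^ c ≠ (s i i ^ k) ^ c := by
        intro c hc e
        refine zpow_ne_one_of_forall_pow_ne_one (hroot i)
          (mul_ne_zero hk (Int.natCast_ne_zero.2 hc.ne')) ?_
        rw [zpow_mul, zpow_natCast, div_zpow, div_pow, e, div_self (pow_ne_zero _ hs0)]
      refine notMem_of_mem_of_isPrime (hP.comap _) (isUnit_mon K n _)
        (inv_ne_zero (sub_ne_zero.2 (by simpa using hq 1 one_pos))) ?_ ha hb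
      obtain ⟨c, rfl⟩ := Nat.exists_eq_add_of_lt hab
      have hc := hq (c + 1) c.succ_pos
      rw [inv_zpow, inv_zpow]
      generalize r i i ^ k = x at *
      generalize s i i ^ k = y at *
      intro e
      apply hc
      rw [sub_eq_zero, add_assoc] at e
      simp only [pow_add _ a (c + 1), inv_pow] at e
      have hxa := pow_ne_zero a hr0
      have hya := pow_ne_zero a hs0
      have hxc := pow_ne_zero (c + 1) hr0
      have hyc := pow_ne_zero (c + 1) hs0
      generalize x ^ (c + 1) = xc at *
      generalize y ^ (c + 1) = yc at *
      generalize x ^ a = xa at *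
      generalize y ^ a = ya at *
      field_simp at e
      exact e)
  refine mk_mem_nonZeroDivisors_of_mk_apply (σ i ^ m).toRingEquiv ?_ ?_ hm
  · intro x hx
    simpa using hpow m x hx
  · intro x hx
    have hinv := hpow (-m) x hx
    rw [zpow_neg, zpow_natCast] at hinv
    exact hinv

end MTW
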